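/- Let d ≥ 1 and n ≥ 1 and let μ be a partition of n into at most d parts. Then the matrix M := ρ_≠^μ − (1/binom(n,μ))·ρ_=^n is positive semidefinite, and Tr[M] = 1 − 1/binom(n,μ). -/

import Mathlib

open MeasureTheory Matrix
open scoped ComplexOrder

noncomputable section

/-- The unitary group `U(d)`. -/
abbrev UG (d : ℕ) := Matrix.unitaryGroup (Fin d) ℂ

noncomputable instance (d : ℕ) : MeasurableSpace (UG d) := borel _

instance (d : ℕ) : BorelSpace (UG d) := ⟨rfl⟩

/-- The permutation matrix `ψ(π)` on `(ℂ^d)^{⊗n}`, with `(x,y)` entry `1` iff `y = x ∘ π`. -/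
def psi (d n : ℕ) (π : Equiv.Perm (Fin n)) : Matrix (Fin n → Fin d) (Fin n → Fin d) ℂ :=
  Matrix.of fun x y => if y = x ∘ π then 1 else 0

/-- The symmetrizer `Π_{(n)} = (1/n!) ∑_{π ∈ S_n} ψ(π)`. -/
def symmetrizer (d n : ℕ) : Matrix (Fin n → Fin d) (Fin n → Fin d) ℂ :=
  ((n.factorial : ℂ))⁻¹ • ∑ π : Equiv.Perm (Fin n), psi d n π

/-- The `n`-fold tensor power of a `d × d` matrix: `(U^{⊗n})_{x,y} = ∏ i, U_{x i, y i}`. -/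
def tpow (d n : ℕ) (U : Matrix (Fin d) (Fin d) ℂ) :
    Matrix (Fin n → Fin d) (Fin n → Fin d) ℂ :=
  Matrix.of fun x y => ∏ i, U (x i) (y i)

/-- The list consisting of `μ 0` copies of `0`, then `μ 1` copies of `1`, etc. -/
def wordList (d : ℕ) (μ : Fin d → ℕ) : List (Fin d) :=
  (List.ofFn fun i => List.replicate (μ i) i).flatten

lemma wordList_length (d : ℕ) (μ : Fin d → ℕ) : (wordList d μ).length = ∑ i, μ i := by
  simp [wordList, List.length_flatten, Function.comp, List.sum_ofFn]

/-- The word indexing the basis vector `|e_μ⟩`: the first `μ 0` tensor factors carry the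
first basis label, the next `μ 1` factors the second basis label, etc. -/
def word (d n : ℕ) (μ : Fin d → ℕ) (hsum : ∑ i, μ i = n) (j : Fin n) : Fin d :=
  (wordList d μ).get ⟨j, by rw [wordList_length, hsum]; exact j.isLt⟩

/-- `∫ U^{⊗n} |e_w⟩⟨e_w| (U^{⊗n})^† dq` for a basis word `w` (entrywise Bochner integral). -/
def rhoWord (d n : ℕ) (w : Fin n → Fin d) (q : Measure (UG d)) :
    Matrix (Fin n → Fin d) (Fin n → Fin d) ℂ :=
  Matrix.of fun x y =>
    ∫ U : UG d, tpow d n (U : Matrix (Fin d) (Fin d) ℂ) x w *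
      star (tpow d n (U : Matrix (Fin d) (Fin d) ℂ) y w) ∂q

/-- The Haar-twirled unequal state `ρ_≠^μ`. -/
def rhoNE (d n : ℕ) (μ : Fin d → ℕ) (hsum : ∑ i, μ i = n) (haar : Measure (UG d)) :
    Matrix (Fin n → Fin d) (Fin n → Fin d) ℂ :=
  rhoWord d n (word d n μ hsum) haar

/-- The partition `(n, 0, …, 0)`. -/
def muEq (d n : ℕ) (hd : 0 < d) : Fin d → ℕ := fun i => if i = ⟨0, hd⟩ then n else 0

lemma muEq_sum (d n : ℕ) (hd : 0 < d) : ∑ i, muEq d n hd i = n := by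
  simp [muEq]

/-- The equal state `ρ_=^n = ρ_≠^{(n,0,…,0)}`. -/
def rhoEQ (d n : ℕ) (hd : 0 < d) (haar : Measure (UG d)) :
    Matrix (Fin n → Fin d) (Fin n → Fin d) ℂ :=
  rhoNE d n (muEq d n hd) (muEq_sum d n hd) haar

/-- The set of POVM elements: Hermitian `P` with `0 ⪯ P ⪯ I`. -/
def POVMs (d n : ℕ) : Set (Matrix (Fin n → Fin d) (Fin n → Fin d) ℂ) :=
  {P | P.PosSemidef ∧ (1 - P).PosSemidef}

/-- The average success probability of the test `{P, I - P}` with prior `p` on the equal case. -/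
def successProb (d n : ℕ) (hd : 0 < d) (μ : Fin d → ℕ) (hsum : ∑ i, μ i = n)
    (haar : Measure (UG d)) (p : ℝ) (P : Matrix (Fin n → Fin d) (Fin n → Fin d) ℂ) : ℝ :=
  p * (Matrix.trace (P * rhoEQ d n hd haar)).re +
    (1 - p) * (1 - (Matrix.trace (P * rhoNE d n μ hsum haar)).re)

lemma tpow_mul (d n : ℕ) (U V : Matrix (Fin d) (Fin d) ℂ) :
    tpow d n (U * V) = tpow d n U * tpow d n V := by
  ext x y
  simp only [tpow, Matrix.of_apply, Matrix.mul_apply]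
  rw [Fintype.prod_sum]
  simp [Finset.prod_mul_distrib]

lemma tpow_one (d n : ℕ) : tpow d n 1 = 1 := by
  ext x y
  simp only [tpow, Matrix.of_apply, Matrix.one_apply, funext_iff]
  by_cases h : ∀ i, x i = y i
  · simp [h]
  · rw [if_neg h]
    push Not at h
    obtain ⟨i, hi⟩ := h
    exact Finset.prod_eq_zero (Finset.mem_univ i) (by simp [hi])

lemma tpow_conj (d n : ℕ) (U : Matrix (Fin d) (Fin d) ℂ) :
    tpow d n Uᴴ = (tpow d n U)ᴴ := by
  ext x y
  simp [tpow, Matrix.conjTranspose_apply]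

lemma tpow_star_mul (d n : ℕ) (U : UG d) :
    (tpow d n (U : Matrix (Fin d) (Fin d) ℂ))ᴴ * tpow d n (U : Matrix (Fin d) (Fin d) ℂ) = 1 := by
  rw [← tpow_conj, ← tpow_mul, ← tpow_one]
  congr 1
  exact (Matrix.mem_unitaryGroup_iff').1 U.2

lemma psi_mul (d n : ℕ) (π σ : Equiv.Perm (Fin n)) :
    psi d n π * psi d n σ = psi d n (π * σ) := by
  ext x y
  simp only [psi, Matrix.mul_apply, Matrix.of_apply, ite_mul, one_mul, zero_mul,
    Finset.sum_ite_eq', Finset.sum_ite_eq, Finset.mem_univ, if_true]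
  rfl

lemma psi_conj (d n : ℕ) (π : Equiv.Perm (Fin n)) : (psi d n π)ᴴ = psi d n π⁻¹ := by
  ext x y
  simp only [psi, Matrix.conjTranspose_apply, Matrix.of_apply]
  have : x = y ∘ π ↔ y = x ∘ ⇑(π⁻¹) := by
    constructor
    · rintro rfl; ext i; simp
    · rintro rfl; ext i; simp
  simp only [this]
  split_ifs <;> simp

lemma tpow_psi (d n : ℕ) (π : Equiv.Perm (Fin n)) (U : Matrix (Fin d) (Fin d) ℂ) :
    tpow d n U * psi d n π = psi d n π * tpow d n U := by
  ext x y
  simp only [psi, tpow, Matrix.mul_apply, Matrix.of_apply]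
  have h : ∀ z : Fin n → Fin d, (y = z ∘ π) ↔ z = y ∘ ⇑(π⁻¹) := by
    intro z
    constructor
    · rintro rfl; ext i; simp
    · rintro rfl; ext i; simp
  simp only [h]
  simp
  rw [← Equiv.prod_comp π]
  simp

lemma psi_symm (d n : ℕ) (π : Equiv.Perm (Fin n)) :
    psi d n π * symmetrizer d n = symmetrizer d n := by
  simp only [symmetrizer, Matrix.mul_smul, Finset.mul_sum, psi_mul]
  congr 1
  exact Equiv.sum_comp (Equiv.mulLeft π) (fun σ => psi d n σ)

lemma symm_conj (d n : ℕ) : (symmetrizer d n)ᴴ = symmetrizer d n := by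
  simp only [symmetrizer, Matrix.conjTranspose_smul, Matrix.conjTranspose_sum, psi_conj]
  congr 1
  · simp
  · exact Equiv.sum_comp (Equiv.inv _) (fun σ => psi d n σ)

lemma mul_symm_of (d n : ℕ) (A : Matrix (Fin n → Fin d) (Fin n → Fin d) ℂ)
    (h : ∀ π, A * psi d n π = A) : A * symmetrizer d n = A := by
  simp only [symmetrizer, Matrix.mul_smul, Finset.mul_sum, h]
  simp [Fintype.card_perm, ← Nat.cast_smul_eq_nsmul ℂ, smul_smul, Nat.factorial_ne_zero]

lemma symm_mul_symm (d n : ℕ) : symmetrizer d n * symmetrizer d n = symmetrizer d n := by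
  apply mul_symm_of
  intro π
  have := congrArg Matrix.conjTranspose (psi_symm d n π⁻¹)
  simpa [symm_conj, psi_conj] using this

lemma tpow_symm (d n : ℕ) (U : Matrix (Fin d) (Fin d) ℂ) :
    tpow d n U * symmetrizer d n = symmetrizer d n * tpow d n U := by
  simp only [symmetrizer, Matrix.mul_smul, Matrix.smul_mul, Finset.mul_sum, Finset.sum_mul,
    tpow_psi]

lemma symm_comp (d n : ℕ) (π : Equiv.Perm (Fin n)) (y z : Fin n → Fin d) :
    symmetrizer d n (y ∘ π) z = symmetrizer d n y z := by
  conv_rhs => rw [← psi_symm d n π]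
  simp [Matrix.mul_apply, psi]

lemma symm_apply (d n : ℕ) (y z : Fin n → Fin d) :
    symmetrizer d n y z = (n.factorial : ℂ)⁻¹ *
      ∑ π : Equiv.Perm (Fin n), if z = y ∘ π then 1 else 0 := by
  simp [symmetrizer, Matrix.sum_apply, psi]

/-- The type of a word, as an exponent vector. -/
def wtype {d n : ℕ} (y : Fin n → Fin d) : Fin d →₀ ℕ := ∑ i, Finsupp.single (y i) 1

lemma wtype_apply {d n : ℕ} (y : Fin n → Fin d) (b : Fin d) :
    wtype y b = Fintype.card {a // y a = b} := by
  simp [wtype, Finsupp.finsetSum_apply, Finsupp.single_apply, Fintype.card_subtype]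

lemma wtype_perm {d n : ℕ} (y : Fin n → Fin d) (π : Equiv.Perm (Fin n)) :
    wtype (y ∘ π) = wtype y :=
  Equiv.sum_comp π (fun i => Finsupp.single (y i) 1)

lemma exists_perm {d n : ℕ} (y z : Fin n → Fin d) (h : wtype y = wtype z) :
    ∃ σ : Equiv.Perm (Fin n), y = z ∘ σ := by
  have e : ∀ b, {a // y a = b} ≃ {a // z a = b} := fun b =>
    Fintype.equivOfCardEq (by rw [← wtype_apply, ← wtype_apply, h])
  refine ⟨(Equiv.sigmaFiberEquiv y).symm.trans
    ((Equiv.sigmaCongrRight e).trans (Equiv.sigmaFiberEquiv z)), ?_⟩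
  ext a
  have := (e (y a) ⟨a, rfl⟩).2
  simp only [Function.comp_apply, Equiv.trans_apply]
  exact congrArg Fin.val this.symm

lemma symm_type (d n : ℕ) (y z : Fin n → Fin d) :
    symmetrizer d n y z = if wtype y = wtype z then symmetrizer d n z z else 0 := by
  split_ifs with h
  · obtain ⟨σ, rfl⟩ := exists_perm y z h
    exact symm_comp d n σ z z
  · rw [symm_apply, Finset.sum_eq_zero, mul_zero]
    intro π _
    rw [if_neg]
    rintro rfl
    exact h (wtype_perm y π).symm

/-- polarization -/
lemma mul_symm_zero (d n : ℕ) (B : Matrix (Fin n → Fin d) (Fin n → Fin d) ℂ)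
    (h : ∀ (u : Fin d → ℂ) x, ∑ y, B x y * ∏ i, u (y i) = 0) : B * symmetrizer d n = 0 := by
  ext x z
  have hp : (∑ y : Fin n → Fin d, MvPolynomial.monomial (wtype y) (B x y)) = 0 := by
    apply MvPolynomial.funext
    intro u
    have hh := h u x
    simp only [map_sum, map_zero]
    rw [← hh]
    refine Finset.sum_congr rfl fun y _ => ?_
    rw [MvPolynomial.eval_monomial]
    congr 1
    rw [wtype, ← Finsupp.prod_finsetSum_index (by simp) (by intros; exact pow_add _ _ _)]
    simp
  have hc := congrArg (MvPolynomial.coeff (wtype z)) hp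
  simp only [MvPolynomial.coeff_sum, MvPolynomial.coeff_monomial, MvPolynomial.coeff_zero] at hc
  rw [Matrix.mul_apply, Matrix.zero_apply]
  calc ∑ y, B x y * symmetrizer d n y z
      = ∑ y, (if wtype y = wtype z then B x y else 0) * symmetrizer d n z z := by
        refine Finset.sum_congr rfl fun y _ => ?_
        rw [symm_type]; split_ifs <;> simp
    _ = 0 := by rw [← Finset.sum_mul, hc, zero_mul]

lemma exists_unitary (d : ℕ) (o : Fin d) (u : EuclideanSpace ℂ (Fin d)) (hu : ‖u‖ = 1) :
    ∃ U : UG d, ∀ i, (U : Matrix (Fin d) (Fin d) ℂ) i o = u i := by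
  have ho : Orthonormal ℂ (({o} : Set (Fin d)).domRestrict (fun _ => u)) := by
    constructor
    · intro i; exact hu
    · intro i j hij
      exact absurd (Subsingleton.elim i j) hij
  obtain ⟨b, hb⟩ := ho.exists_orthonormalBasis_extension_of_card_eq (by simp)
  refine ⟨⟨_, (EuclideanSpace.basisFun (Fin d) ℂ).toMatrix_orthonormalBasis_mem_unitary b⟩, ?_⟩
  intro i
  simp [Module.Basis.toMatrix_apply, hb o rfl]

lemma diag_entry (d n : ℕ) (o : Fin d) (A : Matrix (Fin n → Fin d) (Fin n → Fin d) ℂ)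
    (hA : ∀ U : UG d, A * tpow d n U = tpow d n U * A) (x : Fin n → Fin d)
    (hx : x ≠ fun _ => o) : A x (fun _ => o) = 0 := by
  obtain ⟨k, hk⟩ : ∃ k, x k ≠ o := by
    by_contra! hh
    exact hx (funext hh)
  have hn : n ≠ 0 := by rintro rfl; exact k.elim0
  let ζ : ℂ := Complex.exp (2 * Real.pi * Complex.I / ((n + 1 : ℕ) : ℂ))
  have hζ : IsPrimitiveRoot ζ (n + 1) := Complex.isPrimitiveRoot_exp (n + 1) n.succ_ne_zero
  have hζ1 : ζ * star ζ = 1 := by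
    have := Complex.conj_mul' ζ
    rw [mul_comm]
    rw [hζ.norm'_eq_one n.succ_ne_zero] at this
    simpa using this
  let D : Matrix (Fin d) (Fin d) ℂ := Matrix.diagonal (fun i => if i = o then ζ else 1)
  have hD : D ∈ Matrix.unitaryGroup (Fin d) ℂ := by
    rw [Matrix.mem_unitaryGroup_iff, Matrix.star_eq_conjTranspose, Matrix.diagonal_conjTranspose,
      Matrix.diagonal_mul_diagonal, ← Matrix.diagonal_one]
    congr 1
    ext i
    by_cases hi : i = o
    · simpa [hi] using hζ1
    · simp [hi]
  have ht : tpow d n D = Matrix.diagonal (fun x => ∏ i, if x i = o then ζ else 1) := by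
    ext x y
    simp only [tpow, D, Matrix.of_apply, Matrix.diagonal_apply]
    by_cases h : x = y
    · subst h; simp
    · rw [if_neg h]
      obtain ⟨i, hi⟩ := Function.ne_iff.1 h
      exact Finset.prod_eq_zero (Finset.mem_univ i) (by simp [hi])
  have := congrFun (congrFun (hA ⟨D, hD⟩) x) (fun _ => o)
  simp only [ht, Matrix.mul_diagonal, Matrix.diagonal_mul] at this
  simp only [if_true, Finset.prod_const, Finset.card_univ, Fintype.card_fin,
    mul_one, Finset.prod_ite, one_pow] at this
  set m := (Finset.univ.filter (fun i => x i = o)).card with hm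
  have hmn : m < n := by
    have : m < (Finset.univ : Finset (Fin n)).card := by
      apply Finset.card_lt_card
      rw [Finset.ssubset_univ_iff]
      intro h
      have := Finset.mem_univ k
      rw [← h] at this
      exact hk (by simpa using this)
    simpa using this
  have hne : ζ ^ n ≠ ζ ^ m := fun h =>
    hmn.ne' (hζ.pow_inj (by omega) (by omega) h)
  have h0 : (ζ ^ n - ζ ^ m) * A x (fun _ => o) = 0 := by linear_combination this
  exact (mul_eq_zero.1 h0).resolve_left (sub_ne_zero.2 hne)

lemma mul_symm_scalar (d n : ℕ) (o : Fin d) (A : Matrix (Fin n → Fin d) (Fin n → Fin d) ℂ)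
    (hA : ∀ U : UG d, A * tpow d n U = tpow d n U * A) :
    ∃ c : ℂ, A * symmetrizer d n = c • symmetrizer d n := by
  refine ⟨A (fun _ => o) (fun _ => o), ?_⟩
  set c := A (fun _ => o) (fun _ => o) with hc
  have key : (A - c • 1) * symmetrizer d n = 0 := by
    apply mul_symm_zero
    have h1 : ∀ (U : UG d) (x : Fin n → Fin d), ∑ y : Fin n → Fin d, (A - c • (1 : Matrix (Fin n → Fin d) (Fin n → Fin d) ℂ)) x y * ∏ i, (U : Matrix (Fin d) (Fin d) ℂ) (y i) o = 0 := by
      intro U x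
      have e : (A - c • 1) * tpow d n U = tpow d n U * (A - c • 1) := by
        simp [sub_mul, mul_sub, hA]
      have e2 := congrFun (congrFun e x) (fun _ => o)
      simp only [Matrix.mul_apply] at e2
      refine Eq.trans e2 (Finset.sum_eq_zero fun y _ => ?_)
      by_cases hy : y = fun _ => o
      · subst hy; simp [hc]
      · simp [diag_entry d n o A hA y hy, Matrix.one_apply, hy]
    intro u x
    by_cases hu : u = 0
    · subst hu
      by_cases hn : n = 0
      · subst hn
        simpa using h1 1 x
      · simp [hn]
    · set v : EuclideanSpace ℂ (Fin d) := WithLp.toLp 2 u with hv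
      have hv0 : v ≠ 0 := by
        intro h
        apply hu
        ext i
        exact congrArg (fun w : EuclideanSpace ℂ (Fin d) => w i) h
      have hn0 : (‖v‖ : ℂ) ≠ 0 := by simpa using hv0
      obtain ⟨U, hU⟩ := exists_unitary d o ((‖v‖ : ℂ)⁻¹ • v) (by
        rw [norm_smul]; simp [hv0])
      have h2 := h1 U x
      have h3 : ∀ i, u i = ‖v‖ * (U : Matrix (Fin d) (Fin d) ℂ) i o := by
        intro i
        rw [hU]
        simp [hv]
        rw [← mul_assoc, mul_inv_cancel₀ (by simpa [hv] using hn0), one_mul]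
      simp only [h3, Finset.prod_mul_distrib, Finset.prod_const]
      calc _ = (‖v‖ : ℂ) ^ (Finset.univ : Finset (Fin n)).card *
            ∑ y, (A - c • (1 : Matrix (Fin n → Fin d) (Fin n → Fin d) ℂ)) x y * ∏ i, (U : Matrix (Fin d) (Fin d) ℂ) (y i) o := by
            rw [Finset.mul_sum]
            refine Finset.sum_congr rfl fun y _ => by ring
        _ = 0 := by rw [h2, mul_zero]
  rw [sub_mul, sub_eq_zero] at key
  simpa using key

lemma tpow_norm_le (d n : ℕ) (U : UG d) (x w : Fin n → Fin d) :
    ‖tpow d n (U : Matrix (Fin d) (Fin d) ℂ) x w‖ ≤ 1 := by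
  simp only [tpow, Matrix.of_apply, norm_prod]
  exact Finset.prod_le_one (fun _ _ => norm_nonneg _)
    (fun i _ => entry_norm_bound_of_unitary U.2 _ _)

lemma tpow_cont (d n : ℕ) (x w : Fin n → Fin d) :
    Continuous (fun U : UG d => tpow d n (U : Matrix (Fin d) (Fin d) ℂ) x w) := by
  simp only [tpow, Matrix.of_apply]
  refine continuous_finsetProd _ fun i _ => ?_
  exact continuous_subtype_val.matrix_elem _ _

lemma rho_int (d n : ℕ) (w : Fin n → Fin d) (q : Measure (UG d)) [IsProbabilityMeasure q]
    (x y : Fin n → Fin d) :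
    Integrable (fun U : UG d => tpow d n (U : Matrix (Fin d) (Fin d) ℂ) x w *
      star (tpow d n (U : Matrix (Fin d) (Fin d) ℂ) y w)) q := by
  refine Integrable.of_bound (C := 1) ?_ ?_
  · exact ((tpow_cont d n x w).mul (tpow_cont d n y w).star).aestronglyMeasurable
  · refine Filter.Eventually.of_forall fun U => ?_
    rw [norm_mul, norm_star]
    exact mul_le_one₀ (tpow_norm_le d n U x w) (norm_nonneg _) (tpow_norm_le d n U y w)

lemma rho_lin (d n : ℕ) (w : Fin n → Fin d) (q : Measure (UG d)) [IsProbabilityMeasure q]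
    (a : (Fin n → Fin d) → (Fin n → Fin d) → ℂ) :
    ∑ x, ∑ y, a x y * rhoWord d n w q x y =
      ∫ U : UG d, ∑ x, ∑ y, a x y * (tpow d n (U : Matrix (Fin d) (Fin d) ℂ) x w *
      star (tpow d n (U : Matrix (Fin d) (Fin d) ℂ) y w)) ∂q := by
  rw [integral_finsetSum _ fun x _ => integrable_finsetSum _ fun y _ =>
    (rho_int d n w q x y).const_mul _]
  refine Finset.sum_congr rfl fun x _ => ?_
  rw [integral_finsetSum _ fun y _ => (rho_int d n w q x y).const_mul _]
  refine Finset.sum_congr rfl fun y _ => ?_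
  rw [integral_const_mul]
  rfl

lemma rho_trace (d n : ℕ) (w : Fin n → Fin d) (q : Measure (UG d)) [IsProbabilityMeasure q]
    (N : Matrix (Fin n → Fin d) (Fin n → Fin d) ℂ)
    (hN : ∀ U : UG d, tpow d n U * N = N * tpow d n U) :
    Matrix.trace (rhoWord d n w q * N) = N w w := by
  have h1 : Matrix.trace (rhoWord d n w q * N) = ∑ x, ∑ y, N y x * rhoWord d n w q x y := by
    simp only [Matrix.trace, Matrix.diag_apply, Matrix.mul_apply]
    simp only [mul_comm]
  rw [h1, rho_lin d n w q (fun x y => N y x)]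
  have h2 : ∀ U : UG d, ∑ x, ∑ y, N y x * (tpow d n (U : Matrix (Fin d) (Fin d) ℂ) x w *
      star (tpow d n (U : Matrix (Fin d) (Fin d) ℂ) y w)) = N w w := by
    intro U
    have h3 : (tpow d n (U : Matrix (Fin d) (Fin d) ℂ))ᴴ *
        (N * tpow d n (U : Matrix (Fin d) (Fin d) ℂ)) = N := by
      rw [← hN, ← mul_assoc, tpow_star_mul, one_mul]
    conv_rhs => rw [← h3]
    simp only [Matrix.mul_apply, Matrix.conjTranspose_apply, Finset.mul_sum]
    rw [Finset.sum_comm]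
    refine Finset.sum_congr rfl fun x _ => Finset.sum_congr rfl fun y _ => by ring
  simp_rw [h2]
  simp

lemma rho_psd (d n : ℕ) (w : Fin n → Fin d) (q : Measure (UG d)) [IsProbabilityMeasure q] :
    (rhoWord d n w q).PosSemidef := by
  refine .of_dotProduct_mulVec_nonneg ?_ fun v => ?_
  · ext x y
    simp only [Matrix.conjTranspose_apply, rhoWord, Matrix.of_apply]
    rw [← starRingEnd_apply, ← integral_conj]
    congr 1
    ext U
    simp [mul_comm]
  · have h1 : star v ⬝ᵥ (rhoWord d n w q *ᵥ v) =
        ∑ x, ∑ y, (star (v x) * v y) * rhoWord d n w q x y := by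
      simp only [dotProduct, Matrix.mulVec, Finset.mul_sum, Pi.star_apply]
      refine Finset.sum_congr rfl fun x _ => Finset.sum_congr rfl fun y _ => by ring
    rw [h1, rho_lin d n w q (fun x y => star (v x) * v y)]
    apply integral_nonneg
    intro U
    have h2 : ∑ x, ∑ y, (star (v x) * v y) * (tpow d n (U : Matrix (Fin d) (Fin d) ℂ) x w *
        star (tpow d n (U : Matrix (Fin d) (Fin d) ℂ) y w)) =
        (∑ x, star (v x) * tpow d n (U : Matrix (Fin d) (Fin d) ℂ) x w) *
        star (∑ x, star (v x) * tpow d n (U : Matrix (Fin d) (Fin d) ℂ) x w) := by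
      rw [star_sum, Finset.sum_mul_sum]
      refine Finset.sum_congr rfl fun x _ => Finset.sum_congr rfl fun y _ => ?_
      rw [star_mul', star_star]; ring
    exact le_of_le_of_eq (mul_star_self_nonneg _) h2.symm

lemma rho_comm (d n : ℕ) (w : Fin n → Fin d) (q : Measure (UG d)) [IsProbabilityMeasure q]
    (hinv : ∀ V : UG d, Measure.map (fun U => V * U) q = q) (V : UG d) :
    rhoWord d n w q * tpow d n V = tpow d n V * rhoWord d n w q := by
  have h : tpow d n V * rhoWord d n w q * (tpow d n V)ᴴ = rhoWord d n w q := by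
    ext x y
    have h1 : (tpow d n V * rhoWord d n w q * (tpow d n V)ᴴ) x y =
        ∑ a, ∑ b, (tpow d n V x a * star (tpow d n V y b)) * rhoWord d n w q a b := by
      simp only [Matrix.mul_apply, Matrix.conjTranspose_apply, Finset.sum_mul]
      rw [Finset.sum_comm]
      refine Finset.sum_congr rfl fun x _ => Finset.sum_congr rfl fun y _ => by ring
    rw [h1, rho_lin d n w q (fun a b => tpow d n V x a * star (tpow d n V y b))]
    simp only [rhoWord, Matrix.of_apply]
    conv_rhs => rw [← hinv V]
    rw [integral_map]
    · congr 1
      ext U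
      rw [show ((V * U : UG d) : Matrix (Fin d) (Fin d) ℂ) = V * U from rfl, tpow_mul,
        Matrix.mul_apply, Matrix.mul_apply, star_sum, Finset.sum_mul_sum]
      refine Finset.sum_congr rfl fun x _ => Finset.sum_congr rfl fun y _ => ?_
      rw [star_mul']; ring
    · exact (continuous_const.mul continuous_id).measurable.aemeasurable
    · exact ((tpow_cont d n x w).mul (tpow_cont d n y w).star).aestronglyMeasurable
  calc rhoWord d n w q * tpow d n V
      = tpow d n V * rhoWord d n w q * ((tpow d n V)ᴴ * tpow d n V) := by
        rw [← mul_assoc, h]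
    _ = _ := by rw [tpow_star_mul, mul_one]

lemma count_word (d n : ℕ) (μ : Fin d → ℕ) (hsum : ∑ i, μ i = n) (b : Fin d) :
    Fintype.card {a // word d n μ hsum a = b} = μ b := by
  subst hsum
  have h : List.ofFn (word d _ μ rfl) = wordList d μ := by
    apply List.ext_get
    · simp [wordList_length]
    · intro k h1 h2
      simp [word]
  have h2 : (wordList d μ).count b = μ b := by
    simp [wordList, List.count_flatten, List.map_ofFn, Function.comp_def, List.count_replicate,
      List.sum_ofFn]
  rw [← h2, ← h, Fintype.card_subtype, ← Multiset.coe_count, ← Fin.univ_val_map,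
    Multiset.count_map]
  simp only [eq_comm (a := b)]
  rfl

lemma symm_word (d n : ℕ) (μ : Fin d → ℕ) (hsum : ∑ i, μ i = n) :
    symmetrizer d n (word d n μ hsum) (word d n μ hsum) =
      ((Nat.multinomial Finset.univ μ : ℕ) : ℂ)⁻¹ := by
  rw [symm_apply, Finset.sum_boole]
  have h := DomMulAct.stabilizer_card (word d n μ hsum)
  simp only [count_word] at h
  rw [Fintype.card_subtype] at h
  simp only [eq_comm (a := word d n μ hsum)]
  rw [h]
  have h2 := Nat.multinomial_spec Finset.univ μ
  rw [hsum] at h2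
  rw [← h2]
  have h3 : ((∏ i, (μ i).factorial : ℕ) : ℂ) ≠ 0 := by
    exact_mod_cast Finset.prod_ne_zero_iff.2 fun i _ => Nat.factorial_ne_zero _
  rw [Nat.cast_mul, mul_inv, mul_right_comm, inv_mul_cancel₀ h3, one_mul]

lemma word_eq_const (d n : ℕ) (hd : 0 < d) (j : Fin n) :
    word d n (muEq d n hd) (muEq_sum d n hd) j = ⟨0, hd⟩ := by
  by_contra h
  have h1 := count_word d n (muEq d n hd) (muEq_sum d n hd) (word d n (muEq d n hd) (muEq_sum d n hd) j)
  rw [muEq, if_neg h] at h1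
  exact (Fintype.card_eq_zero_iff.1 h1).false ⟨j, rfl⟩

lemma rhoEQ_symm (d n : ℕ) (hd : 0 < d) (q : Measure (UG d)) :
    rhoEQ d n hd q * symmetrizer d n = rhoEQ d n hd q := by
  apply mul_symm_of
  intro π
  ext x y
  have h : ∀ z : Fin n → Fin d, (y = z ∘ π) ↔ z = y ∘ ⇑(π⁻¹) := by
    intro z
    constructor
    · rintro rfl; ext i; simp
    · rintro rfl; ext i; simp
  simp only [Matrix.mul_apply, psi, Matrix.of_apply, h, mul_ite, mul_one, mul_zero,
    Finset.sum_ite_eq', Finset.sum_ite_eq, Finset.mem_univ, if_true]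
  simp only [rhoEQ, rhoNE, rhoWord, Matrix.of_apply, tpow, word_eq_const, Function.comp_apply]
  congr 1
  ext U
  congr 2
  exact Equiv.prod_comp π⁻¹ (fun i => (U : Matrix (Fin d) (Fin d) ℂ) (y i) ⟨0, hd⟩)

/-- `M = ρ_≠^μ − (1/binom(n,μ)) ρ_=^n` is positive semidefinite with
trace `1 − 1/binom(n,μ)`. -/
theorem rhoNE_sub_rhoEQ_posSemidef (d n : ℕ) (hd : 1 ≤ d) (hn : 1 ≤ n)
    (μ : Fin d → ℕ) (hmono : ∀ i j : Fin d, i ≤ j → μ j ≤ μ i) (hsum : ∑ i, μ i = n)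
    (haar : Measure (UG d)) [IsProbabilityMeasure haar]
    (hinv : ∀ V : UG d, Measure.map (fun U => V * U) haar = haar) :
    (rhoNE d n μ hsum haar -
        ((Nat.multinomial Finset.univ μ : ℂ))⁻¹ • rhoEQ d n (by omega) haar).PosSemidef ∧
    Matrix.trace (rhoNE d n μ hsum haar -
        ((Nat.multinomial Finset.univ μ : ℂ))⁻¹ • rhoEQ d n (by omega) haar)
      = 1 - ((Nat.multinomial Finset.univ μ : ℂ))⁻¹ := by
  have hd' : 0 < d := by omega
  set S := symmetrizer d n with hS
  set R := rhoNE d n μ hsum haar with hR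
  set E := rhoEQ d n hd' haar with hE
  set k : ℂ := ((Nat.multinomial Finset.univ μ : ℂ))⁻¹ with hk
  obtain ⟨c, hc⟩ := mul_symm_scalar d n ⟨0, hd'⟩ R (rho_comm d n _ haar hinv)
  obtain ⟨e, he⟩ := mul_symm_scalar d n ⟨0, hd'⟩ E (rho_comm d n _ haar hinv)
  have hES : E * S = E := rhoEQ_symm d n hd' haar
  have tR : Matrix.trace R = 1 := by
    have := rho_trace d n (word d n μ hsum) haar 1 (by simp)
    rw [mul_one, Matrix.one_apply_eq] at this
    exact this
  have tE : Matrix.trace E = 1 := by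
    have := rho_trace d n (word d n (muEq d n hd') (muEq_sum d n hd')) haar 1 (by simp)
    rw [mul_one, Matrix.one_apply_eq] at this
    exact this
  have tRS : Matrix.trace (R * S) = k := by
    have := rho_trace d n (word d n μ hsum) haar S (fun U => tpow_symm d n U)
    rw [hS, symm_word] at this
    exact this
  have e1 : e * Matrix.trace S = 1 := by
    have := congrArg Matrix.trace he
    rw [hES, tE, Matrix.trace_smul, smul_eq_mul] at this
    exact this.symm
  have c1 : c * Matrix.trace S = k := by
    have := congrArg Matrix.trace hc
    rw [tRS, Matrix.trace_smul, smul_eq_mul] at this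
    exact this.symm
  have hce : c = k * e := by
    linear_combination e * c1 - c * e1
  have hkE : k • E = R * S := by
    rw [hc, hce, ← hES, he, smul_smul]
  have hpsd : R.PosSemidef := rho_psd d n _ haar
  have hRh : Rᴴ = R := hpsd.1
  have hSh : Sᴴ = S := symm_conj d n
  have hSS : S * S = S := symm_mul_symm d n
  have hSRS : S * R * S = R * S := by
    rw [mul_assoc, hc, Matrix.mul_smul, hSS]
  have hSR : S * R = R * S := by
    have := congrArg Matrix.conjTranspose hSRS
    simp only [Matrix.conjTranspose_mul, hRh, hSh] at this
    rw [← this, ← mul_assoc, hSRS]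
  constructor
  · have := hpsd.conjTranspose_mul_mul_same (1 - S)
    convert this using 1
    rw [Matrix.conjTranspose_sub, hSh, Matrix.conjTranspose_one, hkE]
    simp only [sub_mul, mul_sub, one_mul, mul_one, hSR, mul_assoc, hSS]
    abel
  · rw [Matrix.trace_sub, Matrix.trace_smul, tR, tE, smul_eq_mul, mul_one]

end
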